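/- Let J > d/2 and I < J - d/2. For each symmetric bilinear Hilbert–Schmidt operator A on H_{-J}(T^d), the trace function Tr A(x) := A[δ_x, δ_x] is continuous on T^d, belongs to H_I(T^d), admits the Fourier expansion Tr A(x) = Σ_{l∈ℤ^d} (Σ_{k∈ℤ^d} A[ς_{k-l}, ς_{-k}]) ς_l(x), and Tr : L_2^{HS}(H_{-J}) → H_I is a bounded linear operator; moreover for a kernel operator K_a with smooth kernel a, Tr K_a(x) = a(x,x). -/

import Mathlib

open scoped BigOperators
open Real MeasureTheory

noncomputable section

/-- Squared euclidean norm `|k|²` of a lattice vector `k ∈ ℤ^d`. -/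
def latNormSq (d : ℕ) (k : Fin d → ℤ) : ℝ := ∑ j, ((k j : ℝ)) ^ 2

/-- Sobolev weight `(1+|k|²)^J`. -/
def sobWeight (d : ℕ) (J : ℝ) (k : Fin d → ℤ) : ℝ := (1 + latNormSq d k) ^ J

/-- The character `ς_k(y) = e^{i k·y}`. -/
def charFun (d : ℕ) (k : Fin d → ℤ) (y : Fin d → ℝ) : ℂ :=
  Complex.exp (Complex.I * (∑ j, (k j : ℝ) * y j))

/-- Squared Hilbert–Schmidt norm on `H_{-J}` of a symmetric bilinear operator `A`,
represented by its values `a k l = A[ς_k, ς_l]`. -/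
def hsNormSq (d : ℕ) (J : ℝ) (a : (Fin d → ℤ) → (Fin d → ℤ) → ℂ) : ℝ :=
  ∑' kl : (Fin d → ℤ) × (Fin d → ℤ),
    sobWeight d J kl.1 * sobWeight d J kl.2 * ‖a kl.1 kl.2‖ ^ 2

/-- The trace function `Tr A(x) = A[δ_x, δ_x] = Σ_{k,l} A[ς_k,ς_l] ς_{-k}(x) ς_{-l}(x)`. -/
def trFun (d : ℕ) (a : (Fin d → ℤ) → (Fin d → ℤ) → ℂ) : (Fin d → ℝ) → ℂ :=
  fun y => ∑' kl : (Fin d → ℤ) × (Fin d → ℤ),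
    a kl.1 kl.2 * charFun d (-(kl.1 + kl.2)) y

/-- Fourier coefficients of `Tr A`: `b l = Σ_k A[ς_{k-l}, ς_{-k}]`. -/
def trCoef (d : ℕ) (a : (Fin d → ℤ) → (Fin d → ℤ) → ℂ) (l : Fin d → ℤ) : ℂ :=
  ∑' k : Fin d → ℤ, a (k - l) (-k)

/-- Fourier coefficients of a kernel `a : T^d × T^d → ℂ`, with respect to the
normalized Lebesgue measure. -/
def kernelCoeff (d : ℕ) (aker : (Fin d → ℝ) → (Fin d → ℝ) → ℂ)
    (k l : Fin d → ℤ) : ℂ :=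
  (((2 * π) ^ (2 * d) : ℝ) : ℂ)⁻¹ *
    ∫ p in ((Set.univ.pi fun _ : Fin d => Set.Icc (0 : ℝ) (2 * π)) ×ˢ
        (Set.univ.pi fun _ : Fin d => Set.Icc (0 : ℝ) (2 * π))),
      aker p.1 p.2 * (starRingEnd ℂ) (charFun d k p.1 * charFun d l p.2)

/-- `2π`-periodicity of a kernel in each variable and coordinate. -/
def IsPeriodicKernel (d : ℕ) (aker : (Fin d → ℝ) → (Fin d → ℝ) → ℂ) : Prop :=
  ∀ (y z : Fin d → ℝ) (j : Fin d),
    aker (Function.update y j (y j + 2 * π)) z = aker y z ∧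
    aker y (Function.update z j (z j + 2 * π)) = aker y z

lemma latNormSq_nonneg (d : ℕ) (k : Fin d → ℤ) : 0 ≤ latNormSq d k :=
  Finset.sum_nonneg fun _ _ => sq_nonneg _

lemma sobWeight_pos (d : ℕ) (J : ℝ) (k : Fin d → ℤ) : 0 < sobWeight d J k :=
  Real.rpow_pos_of_pos (by have := latNormSq_nonneg d k; linarith) _

lemma sobWeight_neg (d : ℕ) (J : ℝ) (k : Fin d → ℤ) : sobWeight d J (-k) = sobWeight d J k := by
  simp [sobWeight, latNormSq]

lemma charFun_norm (d : ℕ) (k : Fin d → ℤ) (y : Fin d → ℝ) : ‖charFun d k y‖ = 1 := by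
  unfold _root_.charFun
  rw [mul_comm]
  have := Complex.norm_exp_ofReal_mul_I (∑ j, (k j : ℝ) * y j)
  push_cast at this ⊢
  exact this

lemma charFun_continuous (d : ℕ) (k : Fin d → ℤ) : Continuous (charFun d k) := by
  unfold _root_.charFun
  fun_prop

lemma sobWeight_inv_summable (d : ℕ) (J : ℝ) (hJ : (d : ℝ) / 2 < J) :
    Summable (fun k => (sobWeight d J k)⁻¹) := by
  have h1 := ZLattice.summable_norm_rpow
    (Submodule.span ℤ (Set.range (Pi.basisFun ℝ (Fin d)))) (-(2 * J)) (by
      rw [ZLattice.rank ℝ]; simp; linarith)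
  let φ : (Fin d → ℤ) → Submodule.span ℤ (Set.range (Pi.basisFun ℝ (Fin d))) := fun k =>
    ⟨fun i => (k i : ℝ), by
      rw [Module.Basis.mem_span_iff_repr_mem]
      intro i; exact ⟨k i, by simp⟩⟩
  have hφ : Function.Injective φ := by
    intro k l h
    have := congrArg Subtype.val h
    funext i
    have := congrFun this i
    simpa [φ] using this
  have h2 := h1.comp_injective hφ
  have hJ0 : 0 < J := lt_of_le_of_lt (by positivity) hJ
  refine Summable.of_norm_bounded_eventually h2 ?_
  have : ∀ᶠ k in Filter.cofinite, k ≠ (0 : Fin d → ℤ) := by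
    simp
  filter_upwards [this] with k hk
  have hle : ‖φ k‖ ^ 2 ≤ 1 + latNormSq d k := by
    have hn := latNormSq_nonneg d k
    have : ‖φ k‖ ≤ Real.sqrt (1 + latNormSq d k) := by
      change ‖(fun i => (k i : ℝ))‖ ≤ _
      rw [pi_norm_le_iff_of_nonneg (Real.sqrt_nonneg _)]
      intro i
      apply Real.abs_le_sqrt
      have : (k i : ℝ) ^ 2 ≤ latNormSq d k :=
        Finset.single_le_sum (f := fun j => (k j : ℝ) ^ 2) (fun _ _ => sq_nonneg _)
          (Finset.mem_univ i)
      linarith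
    calc ‖φ k‖ ^ 2 ≤ Real.sqrt (1 + latNormSq d k) ^ 2 := by gcongr
      _ = _ := Real.sq_sqrt (by linarith)
  have hpos : 0 < ‖φ k‖ := by
    rw [norm_pos_iff]
    intro h
    apply hk
    apply hφ
    rw [h]
    ext i; simp [φ]
  rw [norm_of_nonneg (inv_nonneg.2 (sobWeight_pos d J k).le)]
  simp only [Function.comp]
  rw [Real.rpow_neg hpos.le, Real.rpow_mul hpos.le]
  have h3 : (‖φ k‖ ^ (2:ℝ)) ^ J ≤ sobWeight d J k := by
    unfold sobWeight
    rw [Real.rpow_two]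
    exact Real.rpow_le_rpow (by positivity) hle hJ0.le
  have : 0 < (‖φ k‖ ^ (2:ℝ)) ^ J := by positivity
  gcongr

lemma cs_tsum {ι : Type*} (f g : ι → ℝ) (hf : ∀ i, 0 ≤ f i) (hg : ∀ i, 0 ≤ g i)
    (hfs : Summable fun i => f i ^ 2) (hgs : Summable fun i => g i ^ 2) :
    Summable (fun i => f i * g i) ∧
      (∑' i, f i * g i) ^ 2 ≤ (∑' i, f i ^ 2) * ∑' i, g i ^ 2 := by
  have h := Real.summable_and_inner_le_Lp_mul_Lq_tsum_of_nonneg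
    (p := 2) (q := 2) (Real.holderConjugate_iff.2 ⟨by norm_num, by norm_num⟩) hf hg
    (by simpa using hfs) (by simpa using hgs)
  refine ⟨h.1, ?_⟩
  have h2 := h.2
  simp only [Real.rpow_two, ← Real.sqrt_eq_rpow] at h2
  have h0 : 0 ≤ ∑' i, f i * g i := tsum_nonneg fun i => mul_nonneg (hf i) (hg i)
  calc (∑' i, f i * g i) ^ 2 ≤ (√(∑' i, f i ^ 2) * √(∑' i, g i ^ 2)) ^ 2 := by gcongr
    _ = _ := by
      rw [mul_pow, Real.sq_sqrt (tsum_nonneg fun i => sq_nonneg _),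
        Real.sq_sqrt (tsum_nonneg fun i => sq_nonneg _)]

/-- weighted Cauchy–Schwarz -/
lemma cs_weight {ι : Type*} (w x : ι → ℝ) (hw : ∀ i, 0 < w i) (hx : ∀ i, 0 ≤ x i)
    (hws : Summable fun i => (w i)⁻¹) (hs : Summable fun i => w i * x i ^ 2) :
    Summable x ∧ (∑' i, x i) ^ 2 ≤ (∑' i, (w i)⁻¹) * ∑' i, w i * x i ^ 2 := by
  have e1 : ∀ i, (√(w i))⁻¹ ^ 2 = (w i)⁻¹ := fun i => by
    rw [inv_pow, Real.sq_sqrt (hw i).le]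
  have e2 : ∀ i, (√(w i) * x i) ^ 2 = w i * x i ^ 2 := fun i => by
    rw [mul_pow, Real.sq_sqrt (hw i).le]
  have e3 : ∀ i, (√(w i))⁻¹ * (√(w i) * x i) = x i := fun i => by
    have := Real.sqrt_pos.2 (hw i)
    field_simp
  have := cs_tsum (fun i => (√(w i))⁻¹) (fun i => √(w i) * x i) (fun i => by positivity)
    (fun i => mul_nonneg (by positivity) (hx i)) (by simpa only [e1] using hws)
    (by simpa only [e2] using hs)
  simpa only [e1, e2, e3] using this

lemma peetre (d : ℕ) (J : ℝ) (hJ : 0 < J) (k l : Fin d → ℤ) :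
    sobWeight d J l ≤ 4 ^ J * (sobWeight d J (k - l) + sobWeight d J (-k)) := by
  have h0 : latNormSq d l ≤ 2 * (latNormSq d (k - l) + latNormSq d (-k)) := by
    unfold latNormSq
    rw [← Finset.sum_add_distrib, Finset.mul_sum]
    apply Finset.sum_le_sum
    intro i _
    simp only [Pi.sub_apply, Pi.neg_apply]
    push_cast
    nlinarith [sq_nonneg ((k i : ℝ) - l i + k i)]
  have n1 := latNormSq_nonneg d l
  have n2 := latNormSq_nonneg d (k - l)
  have n3 := latNormSq_nonneg d (-k)
  have p2 := sobWeight_pos d J (k - l)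
  have p3 := sobWeight_pos d J (-k)
  have p4 : (0:ℝ) < 4 ^ J := by positivity
  rcases le_total (latNormSq d (k - l)) (latNormSq d (-k)) with h | h
  · have : sobWeight d J l ≤ 4 ^ J * sobWeight d J (-k) := by
      unfold sobWeight
      rw [← Real.mul_rpow (by norm_num) (by linarith)]
      exact Real.rpow_le_rpow (by linarith) (by linarith) hJ.le
    nlinarith
  · have : sobWeight d J l ≤ 4 ^ J * sobWeight d J (k - l) := by
      unfold sobWeight
      rw [← Real.mul_rpow (by norm_num) (by linarith)]
      exact Real.rpow_le_rpow (by linarith) (by linarith) hJ.le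
    nlinarith

lemma conv_bound_aux {G : Type*} [AddCommGroup G] (w : G → ℝ) (hw : ∀ k, 0 < w k) (c : ℝ)
    (l : G) (hS : Summable fun k => (w k)⁻¹)
    (hp : ∀ k, w l ≤ c * (w (k - l) + w (-k))) :
    Summable (fun k => (w (k - l) * w (-k))⁻¹) ∧
    w l * ∑' k, (w (k - l) * w (-k))⁻¹ ≤ c * (2 * ∑' k, (w k)⁻¹) := by
  have hS1 : Summable fun k => (w (k - l))⁻¹ :=
    (Equiv.subRight l).summable_iff.2 hS
  have hS2 : Summable fun k => (w (-k))⁻¹ :=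
    (Equiv.neg G).summable_iff.2 hS
  have hT1 : ∑' k, (w (k - l))⁻¹ = ∑' k, (w k)⁻¹ :=
    (Equiv.subRight l).tsum_eq (fun k => (w k)⁻¹)
  have hT2 : ∑' k, (w (-k))⁻¹ = ∑' k, (w k)⁻¹ :=
    (Equiv.neg G).tsum_eq (fun k => (w k)⁻¹)
  have hb : ∀ k, w l * (w (k - l) * w (-k))⁻¹ ≤
      c * ((w (k - l))⁻¹ + (w (-k))⁻¹) := by
    intro k
    have p2 := hw (k - l)
    have p3 := hw (-k)
    calc _ ≤ (c * (w (k - l) + w (-k))) * (w (k - l) * w (-k))⁻¹ := by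
          gcongr
          exact hp k
      _ = _ := by field_simp; ring
  have hbs : Summable fun k => c * ((w (k - l))⁻¹ + (w (-k))⁻¹) :=
    (hS1.add hS2).mul_left _
  have hs : Summable (fun k => w l * (w (k - l) * w (-k))⁻¹) :=
    Summable.of_nonneg_of_le (fun k => by
      have p1 := hw l
      have p2 := hw (k - l)
      have p3 := hw (-k)
      positivity) hb hbs
  have hs' : Summable (fun k => (w (k - l) * w (-k))⁻¹) :=
    (summable_mul_left_iff (hw l).ne').1 hs
  refine ⟨hs', ?_⟩
  rw [← tsum_mul_left]
  refine (hs.tsum_le_tsum hb hbs).trans (le_of_eq ?_)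
  rw [tsum_mul_left, hS1.tsum_add hS2, hT1, hT2]; ring

lemma conv_bound (d : ℕ) (J I : ℝ) (hJ : (d : ℝ) / 2 < J) (hI : I ≤ J) (l : Fin d → ℤ) :
    Summable (fun k => (sobWeight d J (k - l) * sobWeight d J (-k))⁻¹) ∧
    sobWeight d I l * ∑' k, (sobWeight d J (k - l) * sobWeight d J (-k))⁻¹ ≤
      (4:ℝ) ^ J * (2 * ∑' k, (sobWeight d J k)⁻¹) := by
  have hJ0 : 0 < J := lt_of_le_of_lt (by positivity) hJ
  obtain ⟨h1, h2⟩ := conv_bound_aux (sobWeight d J) (sobWeight_pos d J) ((4:ℝ) ^ J) l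
    (sobWeight_inv_summable d J hJ) (fun k => peetre d J hJ0 k l)
  refine ⟨h1, le_trans ?_ h2⟩
  have hIJ : sobWeight d I l ≤ sobWeight d J l :=
    Real.rpow_le_rpow_of_exponent_le (by have := latNormSq_nonneg d l; linarith) hI
  refine mul_le_mul_of_nonneg_right hIJ (tsum_nonneg fun k => inv_nonneg.2 ?_)
  exact (mul_pos (sobWeight_pos d J _) (sobWeight_pos d J _)).le

/-- the reindexing `(l, k) ↦ (k - l, -k)` -/
def reidx (d : ℕ) : (Fin d → ℤ) × (Fin d → ℤ) ≃ (Fin d → ℤ) × (Fin d → ℤ) where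
  toFun p := (p.2 - p.1, -p.2)
  invFun q := (-(q.1 + q.2), -q.2)
  left_inv p := by ext i <;> simp
  right_inv q := by ext i <;> simp

lemma part_a (d : ℕ) (J I : ℝ) (hJ : (d : ℝ) / 2 < J) (hI : I ≤ J)
    (a : (Fin d → ℤ) → (Fin d → ℤ) → ℂ)
    (hs : Summable (fun kl : (Fin d → ℤ) × (Fin d → ℤ) =>
        sobWeight d J kl.1 * sobWeight d J kl.2 * ‖a kl.1 kl.2‖ ^ 2)) :
    Summable (fun kl : (Fin d → ℤ) × (Fin d → ℤ) => ‖a kl.1 kl.2‖) ∧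
      Summable (fun l => sobWeight d I l * ‖trCoef d a l‖ ^ 2) ∧
      ∑' l : Fin d → ℤ, sobWeight d I l * ‖trCoef d a l‖ ^ 2 ≤
        ((4:ℝ) ^ J * (2 * ∑' k, (sobWeight d J k)⁻¹)) * hsNormSq d J a := by
  have hS := sobWeight_inv_summable d J hJ
  have hnn : ∀ k, 0 ≤ (sobWeight d J k)⁻¹ := fun k => (inv_pos.2 (sobWeight_pos d J k)).le
  have hSS : Summable (fun kl : (Fin d → ℤ) × (Fin d → ℤ) =>
      (sobWeight d J kl.1 * sobWeight d J kl.2)⁻¹) := by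
    simp only [mul_inv]
    exact hS.mul_of_nonneg hS hnn hnn
  have h1 := (cs_weight (fun kl : (Fin d → ℤ) × (Fin d → ℤ) =>
      sobWeight d J kl.1 * sobWeight d J kl.2) (fun kl => ‖a kl.1 kl.2‖)
      (fun kl => mul_pos (sobWeight_pos d J _) (sobWeight_pos d J _))
      (fun _ => norm_nonneg _) hSS hs).1
  have hs2 : Summable (fun p : (Fin d → ℤ) × (Fin d → ℤ) =>
      sobWeight d J (p.2 - p.1) * sobWeight d J (-p.2) * ‖a (p.2 - p.1) (-p.2)‖ ^ 2) :=
    (reidx d).summable_iff.2 hs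
  have hT : ∑' p : (Fin d → ℤ) × (Fin d → ℤ),
      sobWeight d J (p.2 - p.1) * sobWeight d J (-p.2) * ‖a (p.2 - p.1) (-p.2)‖ ^ 2
      = hsNormSq d J a :=
    (reidx d).tsum_eq (fun kl : (Fin d → ℤ) × (Fin d → ℤ) =>
        sobWeight d J kl.1 * sobWeight d J kl.2 * ‖a kl.1 kl.2‖ ^ 2)
  have hin : ∀ l, Summable fun k =>
      sobWeight d J (k - l) * sobWeight d J (-k) * ‖a (k - l) (-k)‖ ^ 2 :=
    fun l => hs2.prod_factor l
  have hout : Summable fun l => ∑' k,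
      sobWeight d J (k - l) * sobWeight d J (-k) * ‖a (k - l) (-k)‖ ^ 2 := hs2.prod
  rw [hs2.tsum_prod] at hT
  have hb : ∀ l, sobWeight d I l * ‖trCoef d a l‖ ^ 2 ≤
      ((4:ℝ) ^ J * (2 * ∑' k, (sobWeight d J k)⁻¹)) *
      ∑' k, sobWeight d J (k - l) * sobWeight d J (-k) * ‖a (k - l) (-k)‖ ^ 2 := by
    intro l
    obtain ⟨c1, c2⟩ := conv_bound d J I hJ hI l
    obtain ⟨e1, e2⟩ := cs_weight (fun k => sobWeight d J (k - l) * sobWeight d J (-k))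
      (fun k => ‖a (k - l) (-k)‖)
      (fun kl => mul_pos (sobWeight_pos d J _) (sobWeight_pos d J _))
      (fun _ => norm_nonneg _) c1 (hin l)
    have e3 : ‖trCoef d a l‖ ≤ ∑' k, ‖a (k - l) (-k)‖ := norm_tsum_le_tsum_norm e1
    have hR : 0 ≤ ∑' k, sobWeight d J (k - l) * sobWeight d J (-k) * ‖a (k - l) (-k)‖ ^ 2 :=
      tsum_nonneg fun k => mul_nonneg
        (mul_pos (sobWeight_pos d J _) (sobWeight_pos d J _)).le (sq_nonneg _)
    have e4 : ‖trCoef d a l‖ ^ 2 ≤ (∑' k, ‖a (k - l) (-k)‖) ^ 2 :=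
      pow_le_pow_left₀ (norm_nonneg _) e3 2
    calc _ ≤ sobWeight d I l * _ :=
          mul_le_mul_of_nonneg_left (e4.trans e2) (sobWeight_pos d I l).le
      _ = (sobWeight d I l * _) * _ := (mul_assoc _ _ _).symm
      _ ≤ _ := mul_le_mul_of_nonneg_right c2 hR
  have hbs := hout.mul_left ((4:ℝ) ^ J * (2 * ∑' k, (sobWeight d J k)⁻¹))
  have hsum : Summable (fun l => sobWeight d I l * ‖trCoef d a l‖ ^ 2) :=
    Summable.of_nonneg_of_le
      (fun l => mul_nonneg (sobWeight_pos d I l).le (sq_nonneg _)) hb hbs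
  refine ⟨h1, hsum, ?_⟩
  refine (hsum.tsum_le_tsum hb hbs).trans (le_of_eq ?_)
  rw [tsum_mul_left, hT]

lemma part_b (d : ℕ) (a : (Fin d → ℤ) → (Fin d → ℤ) → ℂ)
    (hs : Summable (fun kl : (Fin d → ℤ) × (Fin d → ℤ) => ‖a kl.1 kl.2‖)) :
    Continuous (trFun d a) ∧
      (∀ y, trFun d a y = ∑' l : Fin d → ℤ, trCoef d a l * _root_.charFun d l y) := by
  constructor
  · unfold trFun
    refine continuous_tsum (fun kl => continuous_const.mul (charFun_continuous d _)) hs ?_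
    intro kl y
    rw [norm_mul, charFun_norm, mul_one]
  · intro y
    have hs1 : Summable (fun kl : (Fin d → ℤ) × (Fin d → ℤ) =>
        a kl.1 kl.2 * _root_.charFun d (-(kl.1 + kl.2)) y) := by
      apply Summable.of_norm
      simpa only [norm_mul, charFun_norm, mul_one] using hs
    have e : ∀ p : (Fin d → ℤ) × (Fin d → ℤ), -((p.2 - p.1) + -p.2) = p.1 := by
      intro p; abel
    have hs2 : Summable (fun p : (Fin d → ℤ) × (Fin d → ℤ) =>
        a (p.2 - p.1) (-p.2) * _root_.charFun d p.1 y) := by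
      have := (reidx d).summable_iff.2 hs1
      refine this.congr fun p => ?_
      simp only [reidx, Function.comp, Equiv.coe_fn_mk, e]
    have hT : trFun d a y = ∑' p : (Fin d → ℤ) × (Fin d → ℤ),
        a (p.2 - p.1) (-p.2) * _root_.charFun d p.1 y := by
      unfold trFun
      rw [← (reidx d).tsum_eq]
      refine tsum_congr fun p => ?_
      simp only [reidx, Equiv.coe_fn_mk, e]
    rw [hT, hs2.tsum_prod]
    refine tsum_congr fun l => ?_
    dsimp only
    rw [tsum_mul_right]
    rfl

lemma periodic_shift {κ : Type*} [Fintype κ] [DecidableEq κ] (f : (κ → ℝ) → ℂ) (T : ℝ)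
    (hf : ∀ y j, f (Function.update y j (y j + T)) = f y) (n : κ → ℤ) (y : κ → ℝ) :
    f (y + fun j => n j * T) = f y := by
  let P : AddSubgroup (κ → ℝ) :=
    { carrier := {v | ∀ y, f (y + v) = f y}
      zero_mem' := by intro y; simp
      add_mem' := by
        intro u v hu hv y
        rw [← add_assoc, hv, hu]
      neg_mem' := by
        intro u hu y
        have := hu (y + -u)
        rw [← this]; simp }
  have h1 : ∀ j, Pi.single j T ∈ P := by
    intro j y
    rw [← hf y j]
    congr 1
    ext i
    by_cases h : i = j
    · subst h; simp
    · simp [h]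
  have h2 : (fun j => (n j : ℝ) * T) = ∑ j, n j • (Pi.single j T : κ → ℝ) := by
    ext i
    rw [Finset.sum_apply, Finset.sum_eq_single i]
    · simp
    · intro b _ hb; simp [hb.symm]
    · simp
  have h3 : (fun j => (n j : ℝ) * T) ∈ P := by
    rw [h2]
    exact P.sum_mem fun j _ => P.zsmul_mem (h1 j) _
  exact h3 y

lemma kernel_shift (d : ℕ) (aker : (Fin d → ℝ) → (Fin d → ℝ) → ℂ)
    (hp : IsPeriodicKernel d aker) (y z : Fin d → ℝ) (m n : Fin d → ℤ) :
    aker (y + fun j => m j * (2 * π)) (z + fun j => n j * (2 * π)) = aker y z := by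
  rw [periodic_shift (fun u => aker u _) (2 * π) (fun y j => (hp y _ j).1) m y]
  rw [periodic_shift (fun u => aker y u) (2 * π) (fun z j => (hp y z j).2) n z]

/-- The kernel as a function on `ℝ^(d+d)`, with periods rescaled to one. -/
def kerG (d : ℕ) (aker : (Fin d → ℝ) → (Fin d → ℝ) → ℂ) (x : Fin d ⊕ Fin d → ℝ) : ℂ :=
  aker (fun i => 2 * π * x (Sum.inl i)) (fun i => 2 * π * x (Sum.inr i))

/-- The quotient map to the torus. -/
def torusMk (κ : Type*) (x : κ → ℝ) : UnitAddTorus κ := fun i => (x i : UnitAddCircle)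

lemma torusMk_quot (κ : Type*) : IsOpenQuotientMap (torusMk κ) :=
  IsOpenQuotientMap.piMap (f := fun _ : κ => ((↑) : ℝ → UnitAddCircle))
    (fun _ => QuotientAddGroup.isOpenQuotientMap_mk)

lemma kerG_congr (d : ℕ) (aker : (Fin d → ℝ) → (Fin d → ℝ) → ℂ)
    (hp : IsPeriodicKernel d aker) (x x' : Fin d ⊕ Fin d → ℝ)
    (h : torusMk _ x = torusMk _ x') : kerG d aker x = kerG d aker x' := by
  have h1 : ∀ i, ∃ n : ℤ, x i = x' i + n := by
    intro i
    have := congrFun h i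
    simp only [torusMk] at this
    obtain ⟨n, hn⟩ := (QuotientAddGroup.eq_iff_sub_mem.1 this)
    refine ⟨n, ?_⟩
    simp at hn
    linarith
  choose n hn using h1
  unfold kerG
  rw [← kernel_shift d aker hp (fun i => 2 * π * x' (Sum.inl i)) (fun i => 2 * π * x' (Sum.inr i))
    (fun i => n (Sum.inl i)) (fun i => n (Sum.inr i))]
  congr 1
  · ext i; simp only [hn, Pi.add_apply]; ring
  · ext i; simp only [hn, Pi.add_apply]; ring

lemma exists_torus_fun (d : ℕ) (aker : (Fin d → ℝ) → (Fin d → ℝ) → ℂ)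
    (hc : Continuous (fun p : (Fin d → ℝ) × (Fin d → ℝ) => aker p.1 p.2))
    (hp : IsPeriodicKernel d aker) :
    ∃ F : C(UnitAddTorus (Fin d ⊕ Fin d), ℂ), ∀ x, F (torusMk _ x) = kerG d aker x := by
  have hq := torusMk_quot (Fin d ⊕ Fin d)
  let F : UnitAddTorus (Fin d ⊕ Fin d) → ℂ := fun t => kerG d aker (Function.surjInv hq.surjective t)
  have hF : ∀ x, F (torusMk _ x) = kerG d aker x := fun x =>
    kerG_congr d aker hp _ _ (Function.surjInv_eq hq.surjective _)
  refine ⟨⟨F, ?_⟩, hF⟩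
  rw [hq.isQuotientMap.continuous_iff]
  have : F ∘ torusMk _ = kerG d aker := funext hF
  rw [this]
  unfold kerG
  exact hc.comp (f := fun x : Fin d ⊕ Fin d → ℝ =>
    ((fun i => 2 * π * x (Sum.inl i), fun i => 2 * π * x (Sum.inr i)) :
      (Fin d → ℝ) × (Fin d → ℝ))) (by fun_prop)

lemma charFun_neg (d : ℕ) (k : Fin d → ℤ) (y : Fin d → ℝ) :
    _root_.charFun d (-k) y = (starRingEnd ℂ) (_root_.charFun d k y) := by
  unfold _root_.charFun
  rw [← Complex.exp_conj]
  congr 1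
  simp

lemma charFun_add (d : ℕ) (k l : Fin d → ℤ) (y : Fin d → ℝ) :
    _root_.charFun d (k + l) y = _root_.charFun d k y * _root_.charFun d l y := by
  unfold _root_.charFun
  rw [← Complex.exp_add, ← mul_add, ← Complex.ofReal_add, ← Finset.sum_add_distrib]
  congr 3
  refine Finset.sum_congr rfl fun i _ => ?_
  simp; ring

lemma mFourier_torusMk (d : ℕ) (n : Fin d ⊕ Fin d → ℤ) (x : Fin d ⊕ Fin d → ℝ) :
    UnitAddTorus.mFourier n (torusMk _ x) =
      _root_.charFun d (fun i => n (Sum.inl i)) (fun i => 2 * π * x (Sum.inl i)) *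
      _root_.charFun d (fun i => n (Sum.inr i)) (fun i => 2 * π * x (Sum.inr i)) := by
  have key : ∀ (m : Fin d → ℤ) (z : Fin d → ℝ),
      ∏ i, (fourier (m i) ((z i : ℝ) : UnitAddCircle) : ℂ) =
        _root_.charFun d m (fun i => 2 * π * z i) := by
    intro m z
    unfold _root_.charFun
    push_cast
    rw [Finset.mul_sum, Complex.exp_sum]
    refine Finset.prod_congr rfl fun i _ => ?_
    rw [fourier_coe_apply]
    congr 1
    push_cast
    ring
  simp only [UnitAddTorus.mFourier, ContinuousMap.coe_mk, Fintype.prod_sum_type, torusMk, key]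

open scoped Pointwise in
lemma mFourierCoeff_kernel (d : ℕ) (aker : (Fin d → ℝ) → (Fin d → ℝ) → ℂ)
    (F : C(UnitAddTorus (Fin d ⊕ Fin d), ℂ)) (hF : ∀ x, F (torusMk _ x) = kerG d aker x)
    (n : Fin d ⊕ Fin d → ℤ) :
    UnitAddTorus.mFourierCoeff F n =
      kernelCoeff d aker (fun i => n (Sum.inl i)) (fun i => n (Sum.inr i)) := by
  have hpi : 0 < 2 * π := by positivity
  set k : Fin d → ℤ := fun i => n (Sum.inl i) with hk
  set l : Fin d → ℤ := fun i => n (Sum.inr i) with hl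
  let H : (Fin d → ℝ) × (Fin d → ℝ) → ℂ := fun p =>
    aker p.1 p.2 * (starRingEnd ℂ) (_root_.charFun d k p.1 * _root_.charFun d l p.2)
  let B : Set ((Fin d → ℝ) × (Fin d → ℝ)) :=
    (Set.univ.pi fun _ : Fin d => Set.Icc (0 : ℝ) 1) ×ˢ
        (Set.univ.pi fun _ : Fin d => Set.Icc (0 : ℝ) 1)
  let e := MeasurableEquiv.sumPiEquivProdPi (fun _ : Fin d ⊕ Fin d => ℝ)
  have he : MeasurePreserving e := volume_measurePreserving_sumPiEquivProdPi (fun _ => ℝ)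
  have hset : (2 * π) • B = ((Set.univ.pi fun _ : Fin d => Set.Icc (0 : ℝ) (2 * π)) ×ˢ
        (Set.univ.pi fun _ : Fin d => Set.Icc (0 : ℝ) (2 * π))) := by
    ext p
    rw [Set.mem_smul_set_iff_inv_smul_mem₀ hpi.ne']
    have : ∀ t : ℝ, (0 ≤ (2 * π)⁻¹ * t ∧ (2 * π)⁻¹ * t ≤ 1) ↔ (0 ≤ t ∧ t ≤ 2 * π) := by
      intro t
      rw [mul_nonneg_iff_of_pos_left (inv_pos.2 hpi), inv_mul_le_iff₀ hpi, mul_one]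
    simp only [B, Set.mem_prod, Set.mem_pi, Set.mem_univ, true_imp_iff, Set.mem_Icc,
      Prod.smul_fst, Prod.smul_snd, Pi.smul_apply, smul_eq_mul, this]
  haveI : Measure.IsAddHaarMeasure (volume : Measure ((Fin d → ℝ) × (Fin d → ℝ))) :=
    Measure.prod.instIsAddHaarMeasure (volume : Measure (Fin d → ℝ)) (volume : Measure (Fin d → ℝ))
  have hsc := Measure.setIntegral_comp_smul_of_pos
    (volume : Measure ((Fin d → ℝ) × (Fin d → ℝ))) H B hpi
  rw [hset] at hsc
  have hfr : Module.finrank ℝ ((Fin d → ℝ) × (Fin d → ℝ)) = 2 * d := by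
    simp; ring
  rw [hfr] at hsc
  have hkc : kernelCoeff d aker k l = ∫ p in B, H ((2 * π) • p) := by
    rw [hsc]
    unfold kernelCoeff
    rw [Complex.real_smul]
    push_cast
    rfl
  rw [hkc, UnitAddTorus.mFourierCoeff_eq_integral _ _ (fun _ => 0)]
  rw [← he.setIntegral_preimage_emb e.measurableEmbedding]
  have hB : e ⁻¹' B = Set.Icc (fun _ => 0) (fun _ => 1) := by
    ext x
    simp only [B, Set.mem_preimage, Set.mem_prod, Set.mem_pi, Set.mem_univ, true_imp_iff,
      Set.mem_Icc, Pi.le_def, Sum.forall]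
    change ((∀ i, 0 ≤ x (Sum.inl i) ∧ x (Sum.inl i) ≤ 1) ∧
      (∀ i, 0 ≤ x (Sum.inr i) ∧ x (Sum.inr i) ≤ 1)) ↔ _
    simp only [forall_and]
    tauto
  have hI : {x : Fin d ⊕ Fin d → ℝ | ∀ i, x i ∈ Set.Ioc (0:ℝ) (0 + 1)} =
      Set.univ.pi (fun _ => Set.Ioc (0:ℝ) 1) := by
    ext x; simp
  rw [hB, hI, volume_pi, ← setIntegral_congr_set Measure.univ_pi_Ioc_ae_eq_Icc]
  congr 1
  ext x
  have h1 := mFourier_torusMk d (-n) x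
  have h2 := hF x
  have h3 : (fun i => (-n) (Sum.inl i)) = -k := rfl
  have h4 : (fun i => (-n) (Sum.inr i)) = -l := rfl
  rw [h3, h4, charFun_neg, charFun_neg] at h1
  unfold torusMk at h1 h2
  rw [h1, h2, smul_eq_mul, mul_comm, ← map_mul]
  rfl

lemma part_c (d : ℕ) (a : (Fin d → ℤ) → (Fin d → ℤ) → ℂ)
    (hs : Summable (fun kl : (Fin d → ℤ) × (Fin d → ℤ) => ‖a kl.1 kl.2‖))
    (aker : (Fin d → ℝ) → (Fin d → ℝ) → ℂ)
    (hc : Continuous (fun p : (Fin d → ℝ) × (Fin d → ℝ) => aker p.1 p.2))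
    (hp : IsPeriodicKernel d aker)
    (ha : ∀ k l, a k l = kernelCoeff d aker (-k) (-l)) (y : Fin d → ℝ) :
    trFun d a y = aker y y := by
  obtain ⟨F, hF⟩ := exists_torus_fun d aker hc hp
  let φ : (Fin d ⊕ Fin d → ℤ) ≃ (Fin d → ℤ) × (Fin d → ℤ) :=
    (Equiv.neg _).trans (Equiv.sumArrowEquivProdArrow (Fin d) (Fin d) ℤ)
  have hφ : ∀ n, φ n = (-(fun i => n (Sum.inl i)), -(fun i => n (Sum.inr i))) := fun n => rfl
  have hco : ∀ n, UnitAddTorus.mFourierCoeff F n = a (φ n).1 (φ n).2 := by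
    intro n
    rw [mFourierCoeff_kernel d aker F hF, ha, hφ]
    simp only [neg_neg]
  have hsum : Summable (UnitAddTorus.mFourierCoeff F) := by
    have := φ.summable_iff.2 (Summable.of_norm (f := fun kl : (Fin d → ℤ) × (Fin d → ℤ) =>
      a kl.1 kl.2) hs)
    exact this.congr fun n => (hco n).symm
  let x : Fin d ⊕ Fin d → ℝ := Sum.elim (fun i => (2 * π)⁻¹ * y i) (fun i => (2 * π)⁻¹ * y i)
  have hx1 : (fun i => 2 * π * x (Sum.inl i)) = y := by
    ext i; simp only [x, Sum.elim_inl]; field_simp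
  have hx2 : (fun i => 2 * π * x (Sum.inr i)) = y := by
    ext i; simp only [x, Sum.elim_inr]; field_simp
  have h := UnitAddTorus.hasSum_mFourier_series_apply_of_summable hsum (torusMk _ x)
  rw [hF] at h
  have hG : kerG d aker x = aker y y := by
    unfold kerG; rw [hx1, hx2]
  rw [hG] at h
  rw [← h.tsum_eq]
  unfold trFun
  rw [← φ.tsum_eq]
  refine tsum_congr fun n => ?_
  rw [hco, mFourier_torusMk, hx1, hx2, ← charFun_add, smul_eq_mul, hφ]
  congr 2
  simp only [neg_add, neg_neg]

/-- Let `J > d/2` and `I < J - d/2`.  For each symmetric bilinear Hilbert–Schmidt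
operator `A` on `H_{-J}(T^d)` (represented by its values `a k l = A[ς_k,ς_l]`), the
trace function `Tr A(x) = A[δ_x,δ_x]` is continuous, belongs to `H_I(T^d)`, admits the
Fourier expansion `Tr A = Σ_l (Σ_k A[ς_{k-l},ς_{-k}]) ς_l`, and
`Tr : L₂^{HS}(H_{-J}) → H_I` is bounded; moreover, if `A = K_a` is the kernel operator
of a continuous periodic kernel (so that `A[ς_k,ς_l] = ⟨a, ς_{(-k,-l)}⟩`), then
`Tr K_a(x) = a(x,x)`. -/
theorem trace_of_hilbert_schmidt_bilinear (d : ℕ) (J I : ℝ)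
    (hJ : (d : ℝ) / 2 < J) (hI : I < J - (d : ℝ) / 2) :
    ∃ C > 0, ∀ a : (Fin d → ℤ) → (Fin d → ℤ) → ℂ,
      (∀ k l, a k l = a l k) →
      Summable (fun kl : (Fin d → ℤ) × (Fin d → ℤ) =>
        sobWeight d J kl.1 * sobWeight d J kl.2 * ‖a kl.1 kl.2‖ ^ 2) →
      Continuous (trFun d a) ∧
      Summable (fun l => sobWeight d I l * ‖trCoef d a l‖ ^ 2) ∧
      (∀ y, trFun d a y = ∑' l : Fin d → ℤ, trCoef d a l * charFun d l y) ∧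
      Real.sqrt (∑' l : Fin d → ℤ, sobWeight d I l * ‖trCoef d a l‖ ^ 2)
        ≤ C * Real.sqrt (hsNormSq d J a) ∧
      (∀ aker : (Fin d → ℝ) → (Fin d → ℝ) → ℂ,
        Continuous (fun p : (Fin d → ℝ) × (Fin d → ℝ) => aker p.1 p.2) →
        IsPeriodicKernel d aker →
        (∀ k l, a k l = kernelCoeff d aker (-k) (-l)) →
        ∀ y, trFun d a y = aker y y) := by
  have hIJ : I ≤ J := by
    have : (0:ℝ) ≤ (d : ℝ) / 2 := by positivity
    linarith
  set M : ℝ := (4:ℝ) ^ J * (2 * ∑' k, (sobWeight d J k)⁻¹) with hM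
  have hM0 : 0 ≤ M := mul_nonneg (by positivity) (mul_nonneg (by norm_num)
    (tsum_nonneg fun k => (inv_pos.2 (sobWeight_pos d J k)).le))
  refine ⟨√M + 1, by positivity, ?_⟩
  intro a _ hs
  obtain ⟨h1, h2, h3⟩ := part_a d J I hJ hIJ a hs
  obtain ⟨h4, h5⟩ := part_b d a h1
  refine ⟨h4, h2, h5, ?_, part_c d a h1⟩
  calc _ ≤ √(M * hsNormSq d J a) := Real.sqrt_le_sqrt h3
    _ = √M * √(hsNormSq d J a) := Real.sqrt_mul hM0 _
    _ ≤ _ := by gcongr; linarith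

end
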